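/- For any compact convex body K ⊂ ℝ^d and any halfspace H^+ whose boundary hyperplane contains the center of gravity of K, the volume ratio Vol(K ∩ H^+)/Vol(K) is at most 1 − e^{-1}. -/

import Mathlib

open MeasureTheory RealInnerProductSpace
open Set Filter Topology ENNReal Pointwise

theorem MeasurableSet.measure_eq_iSup_nonempty_isCompact {A : Set ℝ} (hA : MeasurableSet A)
    (hne : A.Nonempty) :
    volume A = ⨆ K : {K : Set ℝ // K ⊆ A ∧ IsCompact K ∧ K.Nonempty}, volume K.1 := by
  refine le_antisymm (le_of_forall_lt fun r hr => ?_) (iSup_le fun K => measure_mono K.2.1)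
  obtain ⟨K, hKA, hK, hrK⟩ := hA.exists_lt_isCompact hr
  obtain ⟨x, hx⟩ := hne
  refine lt_of_lt_of_le hrK ((measure_mono (subset_insert x K)).trans
    (le_iSup (fun K : {K : Set ℝ // K ⊆ A ∧ IsCompact K ∧ K.Nonempty} => volume K.1)
      ⟨insert x K, insert_subset hx hKA, hK.insert x, insert_nonempty x K⟩))

theorem volume_image_mul_add {a : ℝ} (ha : 0 < a) (c : ℝ) (A : Set ℝ) :
    volume ((fun x => a * x + c) '' A) = ENNReal.ofReal a * volume A := by
  have : (fun x => a * x + c) '' A = (fun x => x + c) '' (a • A) := by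
    ext y; simp [mem_smul_set, ← sub_eq_add_neg, eq_sub_iff_add_eq]
  rw [this, image_add_right, measure_preimage_add_right, Measure.addHaar_smul]
  simp [abs_of_pos ha]

theorem IsCompact.add_volume_le {a b : ℝ} (ha : 0 < a) (hb : 0 < b) {A B C : Set ℝ}
    (hA : IsCompact A) (hA' : A.Nonempty) (hB : IsCompact B) (hB' : B.Nonempty)
    (h : ∀ x ∈ A, ∀ y ∈ B, a * x + b * y ∈ C) :
    ENNReal.ofReal a * volume A + ENNReal.ofReal b * volume B ≤ volume C := by
  obtain ⟨p, hp, hpA⟩ := hA.exists_isGreatest hA'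
  obtain ⟨q, hq, hqB⟩ := hB.exists_isLeast hB'
  have h1 : (fun x => a * x + b * q) '' A ⊆ C ∩ Iic (a * p + b * q) := by
    rintro _ ⟨x, hx, rfl⟩
    refine ⟨h x hx q hq, ?_⟩
    have := mul_le_mul_of_nonneg_left (hpA hx) ha.le
    simpa using this
  have h2 : (fun y => b * y + a * p) '' B ⊆ C ∩ Ici (a * p + b * q) := by
    rintro _ ⟨y, hy, rfl⟩
    refine ⟨by simpa [add_comm] using h p hp y hy, ?_⟩
    have := mul_le_mul_of_nonneg_left (hqB hy) hb.le
    simp only [mem_Ici]; linarith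
  have h3 : volume (C ∩ Ici (a * p + b * q)) = volume (C \ Iic (a * p + b * q)) := by
    rw [sdiff_eq, compl_Iic]
    exact measure_congr ((ae_eq_refl C).inter Ioi_ae_eq_Ici.symm)
  rw [← volume_image_mul_add ha (b * q), ← volume_image_mul_add hb (a * p),
    ← measure_inter_add_sdiff C (measurableSet_Iic (a := a * p + b * q)), ← h3]
  exact add_le_add (measure_mono h1) (measure_mono h2)

/-- The one-dimensional Brunn-Minkowski inequality. -/
theorem MeasurableSet.add_volume_le {a b : ℝ} (ha : 0 < a) (hb : 0 < b) {A B C : Set ℝ}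
    (hA : MeasurableSet A) (hA' : A.Nonempty) (hB : MeasurableSet B) (hB' : B.Nonempty)
    (h : ∀ x ∈ A, ∀ y ∈ B, a * x + b * y ∈ C) :
    ENNReal.ofReal a * volume A + ENNReal.ofReal b * volume B ≤ volume C := by
  have key : ∀ {A : Set ℝ}, A.Nonempty →
      Nonempty {K : Set ℝ // K ⊆ A ∧ IsCompact K ∧ K.Nonempty} := by
    rintro A ⟨x, hx⟩
    exact ⟨{x}, by simpa using hx, isCompact_singleton, singleton_nonempty x⟩
  have := key hA'
  have := key hB'
  rw [hA.measure_eq_iSup_nonempty_isCompact hA', hB.measure_eq_iSup_nonempty_isCompact hB',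
    ENNReal.mul_iSup, ENNReal.mul_iSup]
  exact ENNReal.iSup_add_iSup_le fun K L =>
    K.2.2.1.add_volume_le ha hb K.2.2.2 L.2.2.1 L.2.2.2
      fun x hx y hy => h x (K.2.1 hx) y (L.2.1 hy)

theorem ENNReal.geom_mean_le_arith_mean2 {a b : ℝ} (ha : 0 < a) (hb : 0 < b) (hab : a + b = 1)
    (x y : ℝ≥0∞) : x ^ a * y ^ b ≤ ENNReal.ofReal a * x + ENNReal.ofReal b * y := by
  have hpq : (a⁻¹).HolderConjugate b⁻¹ :=
    ⟨by simpa using hab, inv_pos.2 ha, inv_pos.2 hb⟩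
  have := ENNReal.young_inequality (x ^ a) (y ^ b) hpq
  rwa [ENNReal.rpow_rpow_inv ha.ne', ENNReal.rpow_rpow_inv hb.ne', ENNReal.ofReal_inv_of_pos ha,
    ENNReal.ofReal_inv_of_pos hb, div_eq_mul_inv, div_eq_mul_inv, inv_inv, inv_inv, mul_comm x,
    mul_comm y] at this

theorem lintegral_eq_lintegral_volume_lt {f : ℝ → ℝ≥0∞} (hf : Measurable f) (h1 : ∀ x, f x ≤ 1) :
    ∫⁻ x, f x = ∫⁻ t in Ioi 0, volume {x | ENNReal.ofReal t < f x} := by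
  have hf_top : ∀ x, f x ≠ ⊤ := fun x => ne_top_of_le_ne_top one_ne_top (h1 x)
  have := lintegral_eq_lintegral_meas_lt volume (f := fun x => (f x).toReal)
    (Eventually.of_forall fun x => toReal_nonneg) hf.ennreal_toReal.aemeasurable
  simp only [ofReal_toReal (hf_top _)] at this
  rw [this]
  refine setLIntegral_congr_fun measurableSet_Ioi fun t ht => ?_
  simp only [ENNReal.ofReal_lt_iff_lt_toReal (le_of_lt ht) (hf_top _)]

/-- The additive form of the Prékopa-Leindler inequality on the line, for functions with
supremum `1`. -/
theorem add_lintegral_le_lintegral {a b : ℝ} (ha : 0 < a) (hb : 0 < b) (hab : a + b = 1)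
    {f g h : ℝ → ℝ≥0∞} (hf : Measurable f) (hg : Measurable g) (hh : Measurable h)
    (hf1 : ⨆ x, f x = 1) (hg1 : ⨆ x, g x = 1)
    (H : ∀ x y, f x ^ a * g y ^ b ≤ h (a * x + b * y)) :
    ENNReal.ofReal a * (∫⁻ x, f x) + ENNReal.ofReal b * (∫⁻ x, g x) ≤ ∫⁻ x, h x := by
  have hf' : ∀ x, f x ≤ 1 := fun x => hf1 ▸ le_iSup f x
  have hg' : ∀ x, g x ≤ 1 := fun x => hg1 ▸ le_iSup g x
  refine le_trans ?_ (lintegral_mono fun x => min_le_left (h x) 1)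
  rw [lintegral_eq_lintegral_volume_lt hf hf', lintegral_eq_lintegral_volume_lt hg hg',
    lintegral_eq_lintegral_volume_lt (hh.min measurable_const) fun x => min_le_right _ _,
    ← lintegral_const_mul' _ _ ofReal_ne_top, ← lintegral_const_mul' _ _ ofReal_ne_top,
    ← lintegral_add_left (by
      refine Measurable.const_mul (Antitone.measurable fun s t hst => measure_mono ?_) _
      exact fun x hx => lt_of_le_of_lt (ofReal_le_ofReal hst) hx)]
  refine setLIntegral_mono' measurableSet_Ioi fun t ht => ?_
  rcases lt_or_ge t 1 with ht1 | ht1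
  · have ht1' : ENNReal.ofReal t < 1 := by simpa using ht1
    have hne : ∀ f : ℝ → ℝ≥0∞, ⨆ x, f x = 1 → {x | ENNReal.ofReal t < f x}.Nonempty :=
      fun f hf1 => by
        rw [← hf1] at ht1'
        exact lt_iSup_iff.1 ht1'
    refine MeasurableSet.add_volume_le ha hb (measurableSet_lt measurable_const hf)
      (hne f hf1) (measurableSet_lt measurable_const hg)
      (hne g hg1) fun x hx y hy => ?_
    refine lt_min ?_ ht1'
    calc ENNReal.ofReal t = ENNReal.ofReal t ^ a * ENNReal.ofReal t ^ b := by
          rw [← ENNReal.rpow_add _ _ (by simpa using ht) ofReal_ne_top, hab, ENNReal.rpow_one]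
      _ < f x ^ a * g y ^ b :=
          ENNReal.mul_lt_mul (ENNReal.rpow_lt_rpow hx ha) (ENNReal.rpow_lt_rpow hy hb)
      _ ≤ _ := H x y
  · have ht1' : 1 ≤ ENNReal.ofReal t := by simpa using ht1
    simp [((hf' _).trans ht1').not_gt, ((hg' _).trans ht1').not_gt]

theorem prekopaLeindler_of_bounded {a b : ℝ} (ha : 0 < a) (hb : 0 < b) (hab : a + b = 1)
    {f g h : ℝ → ℝ≥0∞} (hf : Measurable f) (hg : Measurable g) (hh : Measurable h)
    (hf1 : ⨆ x, f x ≠ ⊤) (hg1 : ⨆ x, g x ≠ ⊤)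
    (H : ∀ x y, f x ^ a * g y ^ b ≤ h (a * x + b * y)) :
    (∫⁻ x, f x) ^ a * (∫⁻ x, g x) ^ b ≤ ∫⁻ x, h x := by
  set α := ⨆ x, f x with hα
  set β := ⨆ x, g x with hβ
  rcases eq_or_ne α 0 with h0 | hα0
  · have : ∀ x, f x = 0 := by simpa [h0] using hα.symm
    simp [this, ha]
  rcases eq_or_ne β 0 with h0 | hβ0
  · have : ∀ x, g x = 0 := by simpa [h0] using hβ.symm
    simp [this, hb]
  have hγ : α⁻¹ ^ a * β⁻¹ ^ b ≠ 0 := by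
    simp [ha, hb, hf1, hg1, ha.not_gt, hb.not_gt]
  have hγ' : α⁻¹ ^ a * β⁻¹ ^ b ≠ ⊤ :=
    mul_ne_top (rpow_ne_top_of_nonneg ha.le (by simpa using hα0))
      (rpow_ne_top_of_nonneg hb.le (by simpa using hβ0))
  have key := add_lintegral_le_lintegral ha hb hab (hf.const_mul α⁻¹) (hg.const_mul β⁻¹)
    (hh.const_mul (α⁻¹ ^ a * β⁻¹ ^ b))
    (by rw [← ENNReal.mul_iSup, ← hα, ENNReal.inv_mul_cancel hα0 hf1])
    (by rw [← ENNReal.mul_iSup, ← hβ, ENNReal.inv_mul_cancel hβ0 hg1])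
    (fun x y => by
      rw [ENNReal.mul_rpow_of_nonneg _ _ ha.le, ENNReal.mul_rpow_of_nonneg _ _ hb.le,
        mul_mul_mul_comm]
      exact mul_le_mul_right (H x y) _)
  have := (ENNReal.geom_mean_le_arith_mean2 ha hb hab _ _).trans key
  rw [lintegral_const_mul _ hf, lintegral_const_mul _ hg, lintegral_const_mul _ hh,
    ENNReal.mul_rpow_of_nonneg _ _ ha.le, ENNReal.mul_rpow_of_nonneg _ _ hb.le,
    mul_mul_mul_comm] at this
  exact (ENNReal.mul_le_mul_iff_right hγ hγ').1 this

/-- The measure `μ` satisfies the Prékopa-Leindler inequality with weights `a` and `b`. -/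
def PrekopaLeindler {E : Type*} [AddCommGroup E] [Module ℝ E] [MeasurableSpace E]
    (μ : Measure E) (a b : ℝ) : Prop :=
  ∀ ⦃f g h : E → ℝ≥0∞⦄, Measurable f → Measurable g → Measurable h →
    (∀ x y, f x ^ a * g y ^ b ≤ h (a • x + b • y)) →
      (∫⁻ x, f x ∂μ) ^ a * (∫⁻ x, g x ∂μ) ^ b ≤ ∫⁻ x, h x ∂μ

theorem tendsto_lintegral_min_natCast {f : ℝ → ℝ≥0∞} (hf : Measurable f) :
    Tendsto (fun n : ℕ => ∫⁻ x, min (f x) n) atTop (𝓝 (∫⁻ x, f x)) := by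
  refine lintegral_tendsto_of_tendsto_of_monotone
    (fun n => (hf.min measurable_const).aemeasurable)
    (Eventually.of_forall fun x m n hmn => min_le_min_left _ (by exact_mod_cast hmn))
    (Eventually.of_forall fun x => ?_)
  simpa using tendsto_const_nhds.min ENNReal.tendsto_nat_nhds_top

/-- The Prékopa-Leindler inequality on the line. -/
theorem prekopaLeindler_real {a b : ℝ} (ha : 0 < a) (hb : 0 < b) (hab : a + b = 1) :
    PrekopaLeindler (volume : Measure ℝ) a b := by
  intro f g h hf hg hh H
  rcases eq_or_ne (∫⁻ x, f x) 0 with h0 | hf0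
  · simp [h0, ha]
  rcases eq_or_ne (∫⁻ x, g x) 0 with h0 | hg0
  · simp [h0, hb]
  have hlim := ENNReal.Tendsto.mul ((tendsto_lintegral_min_natCast hf).ennrpow_const a)
    (.inl (by simp [hf0, ha.not_gt])) ((tendsto_lintegral_min_natCast hg).ennrpow_const b)
    (.inl (by simp [hg0, hb.not_gt]))
  refine le_of_tendsto' hlim fun n => ?_
  have hn : ∀ f : ℝ → ℝ≥0∞, ⨆ x, min (f x) (n : ℝ≥0∞) ≠ ⊤ := fun f =>
    ne_top_of_le_ne_top (natCast_ne_top n) (iSup_le fun x => min_le_right _ _)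
  refine prekopaLeindler_of_bounded ha hb hab (hf.min measurable_const) (hg.min measurable_const)
    hh (hn f) (hn g) fun x y => le_trans ?_ (H x y)
  gcongr <;> exact min_le_left _ _

theorem PrekopaLeindler.prod {E F : Type*} [AddCommGroup E] [Module ℝ E] [MeasurableSpace E]
    [AddCommGroup F] [Module ℝ F] [MeasurableSpace F] {μ : Measure E} {ν : Measure F}
    [SFinite μ] [SFinite ν] {a b : ℝ} (hμ : PrekopaLeindler μ a b) (hν : PrekopaLeindler ν a b) :
    PrekopaLeindler (μ.prod ν) a b := by
  intro f g h hf hg hh H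
  rw [lintegral_prod _ hf.aemeasurable, lintegral_prod _ hg.aemeasurable,
    lintegral_prod _ hh.aemeasurable]
  exact hμ hf.lintegral_prod_right' hg.lintegral_prod_right' hh.lintegral_prod_right'
    fun x y => hν (hf.comp measurable_prodMk_left) (hg.comp measurable_prodMk_left)
      (hh.comp measurable_prodMk_left) fun z w => H (x, z) (y, w)

theorem PrekopaLeindler.of_measurePreserving {E F : Type*} [AddCommGroup E] [Module ℝ E]
    [MeasurableSpace E] [AddCommGroup F] [Module ℝ F] [MeasurableSpace F] {μ : Measure E}
    {ν : Measure F} {a b : ℝ} (hμ : PrekopaLeindler μ a b) (e : E →ₗ[ℝ] F)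
    (he : MeasurePreserving e μ ν) : PrekopaLeindler ν a b := by
  intro f g h hf hg hh H
  rw [← he.lintegral_comp hf, ← he.lintegral_comp hg, ← he.lintegral_comp hh]
  exact hμ (hf.comp he.measurable) (hg.comp he.measurable) (hh.comp he.measurable)
    fun x y => by simpa using H (e x) (e y)

theorem prekopaLeindler_pi {a b : ℝ} (ha : 0 < a) (hb : 0 < b) (hab : a + b = 1) (n : ℕ) :
    PrekopaLeindler (volume : Measure (Fin n → ℝ)) a b := by
  induction n with
  | zero =>
    intro f g h hf hg hh H
    have h0 : ∀ f : (Fin 0 → ℝ) → ℝ≥0∞, ∫⁻ x, f x = f 0 := fun f => by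
      rw [volume_pi, Measure.pi_of_empty _ 0, lintegral_dirac]
    simpa [h0] using H 0 0
  | succ n ih =>
    refine ((prekopaLeindler_real ha hb hab).prod ih).of_measurePreserving
      (Fin.consLinearEquiv ℝ (fun _ => ℝ)).toLinearMap ?_
    have h : ⇑(Fin.consLinearEquiv ℝ (fun _ : Fin (n + 1) => ℝ)).toLinearMap =
        (MeasurableEquiv.piFinSuccAbove (fun _ : Fin (n + 1) => ℝ) 0).symm := by
      ext x i
      simp [Fin.consLinearEquiv, MeasurableEquiv.piFinSuccAbove, Fin.insertNthEquiv]
    rw [h]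
    exact (volume_preserving_piFinSuccAbove (fun _ : Fin (n + 1) => ℝ) 0).symm _

/-- The Prékopa-Leindler inequality in Euclidean space. -/
theorem prekopaLeindler_euclideanSpace {a b : ℝ} (ha : 0 < a) (hb : 0 < b) (hab : a + b = 1)
    (n : ℕ) : PrekopaLeindler (volume : Measure (EuclideanSpace ℝ (Fin n))) a b :=
  (prekopaLeindler_pi ha hb hab n).of_measurePreserving
    (WithLp.linearEquiv 2 ℝ (Fin n → ℝ)).symm.toLinearMap (PiLp.volume_preserving_toLp (Fin n))

/-- The multiplicative Brunn-Minkowski inequality. -/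
theorem PrekopaLeindler.measure_rpow_mul_le {E : Type*} [AddCommGroup E] [Module ℝ E]
    [MeasurableSpace E] {μ : Measure E} {a b : ℝ} (hμ : PrekopaLeindler μ a b) (ha : 0 < a)
    (hb : 0 < b) {A B C : Set E} (hA : MeasurableSet A) (hB : MeasurableSet B)
    (hC : MeasurableSet C) (h : ∀ x ∈ A, ∀ y ∈ B, a • x + b • y ∈ C) :
    μ A ^ a * μ B ^ b ≤ μ C := by
  have := hμ (measurable_one.indicator hA) (measurable_one.indicator hB)
    (measurable_one.indicator hC) fun x y => by
      by_cases hx : x ∈ A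
      · by_cases hy : y ∈ B
        · simp [hx, hy, h x hx y hy]
        · simp [hy, hb]
      · simp [hx, ha]
  simpa [lintegral_indicator_one, hA, hB, hC] using this

/-- A monotone log-concave function lies below an exponential touching it at `c`. -/
theorem exists_le_mul_exp_of_logConcave {G : ℝ → ℝ} (hG : ∀ t, 0 ≤ G t) (hmono : Monotone G)
    (hlc : ∀ a b s t : ℝ, 0 < a → 0 < b → a + b = 1 → G s ^ a * G t ^ b ≤ G (a * s + b * t))
    {s₀ c : ℝ} (hs₀ : s₀ < c) (hGs₀ : 0 < G s₀) :
    ∃ m : ℝ, ∀ t, G t ≤ G c * Real.exp (m * (t - c)) := by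
  have hpos : ∀ t, s₀ < t → 0 < G t := fun t ht => hGs₀.trans_le (hmono ht.le)
  let S : Set ℝ := {t | 0 < G t}
  have hord : OrdConnected S := ⟨fun x hx y _ z hz => lt_of_lt_of_le hx (hmono hz.1)⟩
  have hconv : ConvexOn ℝ S fun t => -Real.log (G t) := by
    refine convexOn_iff_forall_pos.2 ⟨hord.convex, fun x hx y hy a b ha hb hab => ?_⟩
    have hx' : 0 < G x := hx
    have hy' : 0 < G y := hy
    have := Real.log_le_log (by positivity) (hlc a b x y ha hb hab)
    rw [Real.log_mul (by positivity) (by positivity), Real.log_rpow hx', Real.log_rpow hy'] at this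
    simp only [smul_eq_mul]
    linarith
  have hcS : c ∈ interior S :=
    interior_maximal (fun t ht => hpos t ht) isOpen_Ioi hs₀
  have hc : 0 < G c := hpos c hs₀
  have hlog : ∀ t, 0 < G t → ∀ r, Real.log (G t) ≤ Real.log (G c) + r →
      G t ≤ G c * Real.exp r := fun t ht r h => by
    rwa [← Real.log_le_log_iff ht (by positivity), Real.log_mul hc.ne' (Real.exp_ne_zero _),
      Real.log_exp]
  let D := derivWithin (fun t => -Real.log (G t)) (Ioi c) c
  refine ⟨-D, fun t => ?_⟩
  rcases (hG t).eq_or_lt with h0 | ht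
  · rw [← h0]; positivity
  refine hlog t ht _ ?_
  rcases lt_trichotomy t c with h | rfl | h
  · have h1 := (hconv.slope_le_leftDeriv_of_mem_interior ht hcS h).trans
      (hconv.leftDeriv_le_rightDeriv_of_mem_interior hcS)
    rw [slope_def_field, div_le_iff₀ (by linarith)] at h1
    simp only [D]
    linarith
  · simp
  · have h1 := hconv.rightDeriv_le_slope_of_mem_interior hcS ht h
    rw [slope_def_field, le_div_iff₀ (by linarith)] at h1
    simp only [D]
    linarith

/-- Grünbaum's inequality on the line: if the distribution function of `X` is log-concave, then
`X` is below its mean with probability at least `e⁻¹`. -/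
theorem exp_neg_one_mul_le_measureReal_lt_mean {Ω : Type*} [MeasurableSpace Ω] {μ : Measure Ω}
    [IsFiniteMeasure μ] {X : Ω → ℝ} (hX : Integrable X μ) {c : ℝ}
    (hmean : ∫ ω, X ω ∂μ = μ.real univ * c) (hne : ¬ X =ᵐ[μ] fun _ => c) {M : ℝ}
    (hM : ∀ᵐ ω ∂μ, X ω < M)
    (hlc : ∀ a b s t : ℝ, 0 < a → 0 < b → a + b = 1 →
      μ.real {ω | X ω < s} ^ a * μ.real {ω | X ω < t} ^ b ≤ μ.real {ω | X ω < a * s + b * t}) :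
    Real.exp (-1) * μ.real univ ≤ μ.real {ω | X ω < c} := by
  set G : ℝ → ℝ := fun t => μ.real {ω | X ω < t} with hGdef
  have hG : ∀ t, 0 ≤ G t := fun t => measureReal_nonneg
  have hmono : Monotone G := fun s t hst => measureReal_mono fun ω hω => lt_of_lt_of_le hω hst
  have hGV : ∀ t, G t ≤ μ.real univ := fun t => measureReal_mono (subset_univ _)
  obtain ⟨s₀, hs₀, hGs₀⟩ : ∃ s < c, 0 < G s := by
    by_contra! hcon
    have hae : ∀ᵐ ω ∂μ, c ≤ X ω := by
      have : ∀ n : ℕ, ∀ᵐ ω ∂μ, c - 1 / (n + 1 : ℝ) ≤ X ω := fun n => by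
        have h0 := (hcon (c - 1 / (n + 1 : ℝ)) (sub_lt_self c Nat.one_div_pos_of_nat)).antisymm
          (hG _)
        rw [hGdef, measureReal_eq_zero_iff] at h0
        simpa only [ae_iff, not_le] using h0
      filter_upwards [ae_all_iff.2 this] with ω hω
      have hlim : Tendsto (fun n : ℕ => c - 1 / (n + 1 : ℝ)) atTop (𝓝 (c - 0)) :=
        tendsto_const_nhds.sub tendsto_one_div_add_atTop_nhds_zero_nat
      rw [sub_zero] at hlim
      exact le_of_tendsto' hlim hω
    have hint : ∫ ω, (X ω - c) ∂μ = 0 := by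
      rw [integral_sub hX (integrable_const c), hmean]; simp
    rw [integral_eq_zero_iff_of_nonneg_ae (hae.mono fun ω h => by simpa using h)
      (by fun_prop)] at hint
    exact hne (hint.mono fun ω h => by simpa [sub_eq_zero] using h)
  obtain ⟨m, hm⟩ := exists_le_mul_exp_of_logConcave hG hmono hlc hs₀ hGs₀
  have hc : 0 < G c := hGs₀.trans_le (hmono hs₀.le)
  set V := μ.real univ with hV
  rcases le_or_gt V (G c) with hle | hlt
  · refine le_trans ?_ hle
    have : Real.exp (-1) ≤ 1 := by simp
    nlinarith [hc.trans_le (hGV c)]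
  have hVpos : 0 < V := hc.trans hlt
  have hm0 : 0 < m := by
    have hT : V ≤ G (max M c) := by
      refine ENNReal.toReal_mono (measure_ne_top _ _) (measure_mono_ae ?_)
      filter_upwards [hM] with ω hω _ using hω.trans_le (le_max_left _ _)
    by_contra! hm0
    have : Real.exp (m * (max M c - c)) ≤ 1 :=
      Real.exp_le_one_iff.2 (mul_nonpos_of_nonpos_of_nonneg hm0 (by simp))
    nlinarith [hm (max M c)]
  let T := c + Real.log (V / G c) / m
  have hGT : ∀ s, G (T - s) ≤ V * Real.exp (-m * s) := fun s => by
    refine (hm _).trans_eq ?_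
    have : m * (T - s - c) = Real.log (V / G c) + -m * s := by
      simp only [T]; field_simp; ring
    rw [this, Real.exp_add, Real.exp_log (by positivity)]
    field_simp
  have hlay : ENNReal.ofReal (V * (T - c)) ≤ ENNReal.ofReal (V / m) := by
    have hXT : Integrable (fun ω => T - X ω) μ := (integrable_const T).sub hX
    have hexp : IntegrableOn (fun s : ℝ => V * Real.exp (-m * s)) (Ioi 0) :=
      (integrableOn_exp_mul_Ioi (neg_lt_zero.2 hm0) 0).const_mul V
    calc ENNReal.ofReal (V * (T - c)) = ENNReal.ofReal (∫ ω, (T - X ω) ∂μ) := by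
          rw [integral_sub (integrable_const T) hX, hmean, integral_const, smul_eq_mul, mul_sub]
      _ ≤ ENNReal.ofReal (∫ ω, max (T - X ω) 0 ∂μ) :=
          ofReal_le_ofReal (integral_mono hXT hXT.pos_part fun ω => le_max_left _ _)
      _ = ∫⁻ s in Ioi 0, μ {ω | s < max (T - X ω) 0} := by
          have h0 : 0 ≤ᵐ[μ] fun ω => max (T - X ω) 0 :=
            Eventually.of_forall fun ω => le_max_right _ _
          rw [ofReal_integral_eq_lintegral_ofReal hXT.pos_part h0,
            lintegral_eq_lintegral_meas_lt μ h0 hXT.pos_part.aemeasurable]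
      _ ≤ ∫⁻ s in Ioi 0, ENNReal.ofReal (V * Real.exp (-m * s)) := by
          refine setLIntegral_mono' measurableSet_Ioi fun s hs => ?_
          have : {ω | s < max (T - X ω) 0} = {ω | X ω < T - s} := by
            ext ω
            simp only [mem_ofPred_eq, lt_max_iff, not_lt_of_gt (mem_Ioi.1 hs), or_false]
            exact lt_sub_comm
          rw [this, ← ofReal_measureReal]
          exact ofReal_le_ofReal (hGT s)
      _ = ENNReal.ofReal (V / m) := by
          rw [← ofReal_integral_eq_lintegral_ofReal hexp
            (Eventually.of_forall fun s => by positivity), integral_const_mul,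
            integral_exp_mul_Ioi (neg_lt_zero.2 hm0)]
          congr 1
          simp [div_eq_mul_inv]
  rw [ofReal_le_ofReal_iff (by positivity)] at hlay
  have h1 : Real.log (V / G c) ≤ 1 := by
    have : T - c = Real.log (V / G c) / m := by simp [T]
    rw [this, ← mul_div_assoc, div_le_div_iff_of_pos_right hm0] at hlay
    nlinarith
  rw [Real.log_le_iff_le_exp (by positivity), div_le_iff₀ hc] at h1
  rw [Real.exp_neg, inv_mul_le_iff₀ (Real.exp_pos 1)]
  exact h1

theorem volume_setOf_inner_eq {d : ℕ} {v : EuclideanSpace ℝ (Fin d)} (hv : v ≠ 0) (c : ℝ) :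
    volume {x : EuclideanSpace ℝ (Fin d) | ⟪v, x⟫ = c} = 0 := by
  let A : AffineSubspace ℝ (EuclideanSpace ℝ (Fin d)) :=
    { carrier := {x | ⟪v, x⟫ = c}
      smul_vsub_vadd_mem' := fun r p q s hp hq hs => by
        simp only [mem_ofPred_eq] at hp hq hs ⊢
        simp [inner_add_right, inner_smul_right, inner_sub_right, hp, hq, hs] }
  refine Measure.addHaar_affineSubspace volume A fun hA => ?_
  have hmem : ((c + 1) / ⟪v, v⟫) • v ∈ A := hA ▸ AffineSubspace.mem_top ℝ _ _
  have h2 : ⟪v, ((c + 1) / ⟪v, v⟫) • v⟫ = c := hmem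
  rw [inner_smul_right, div_mul_cancel₀ _ (inner_self_ne_zero.2 hv)] at h2
  linarith

/-- Complementary form of Grünbaum's theorem: for any compact convex body K and any
closed halfspace whose boundary hyperplane contains the center of gravity of K,
Vol(K ∩ H⁺)/Vol(K) ≤ 1 − e⁻¹. -/
theorem grunbaum_complement (d : ℕ) (K : Set (EuclideanSpace ℝ (Fin d)))
    (hKc : IsCompact K) (hKconv : Convex ℝ K) (hvol : 0 < (volume K).toReal)
    (v : EuclideanSpace ℝ (Fin d)) (hv : v ≠ 0) (c : ℝ)
    (hcg : ⟪v, (volume K).toReal⁻¹ • ∫ x in K, x⟫ = c) :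
    (volume (K ∩ {x | c ≤ ⟪v, x⟫})).toReal / (volume K).toReal
      ≤ 1 - (Real.exp 1)⁻¹ := by
  have hfin : IsFiniteMeasure (volume.restrict K) := ⟨by simpa using hKc.measure_lt_top⟩
  have hcont : Continuous fun x : EuclideanSpace ℝ (Fin d) => ⟪v, x⟫ := by fun_prop
  have hmeas : ∀ t, MeasurableSet {x : EuclideanSpace ℝ (Fin d) | ⟪v, x⟫ < t} := fun t =>
    measurableSet_lt hcont.measurable measurable_const
  have hid : Integrable (fun x => x) (volume.restrict K) :=
    continuous_id.continuousOn.integrableOn_compact hKc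
  have hV : (volume.restrict K).real univ = (volume K).toReal := by simp [measureReal_def]
  obtain ⟨M, hM⟩ := (hKc.image hcont).bddAbove
  have hKm := hKc.measurableSet
  have key := exp_neg_one_mul_le_measureReal_lt_mean (μ := volume.restrict K)
    (hcont.continuousOn.integrableOn_compact hKc) (c := c) (M := M + 1)
    (by rw [integral_inner hid, hV, ← hcg, inner_smul_right, mul_inv_cancel_left₀ hvol.ne'])
    (fun h => by
      have hnull : ∀ᵐ x ∂volume.restrict K, ⟪v, x⟫ ≠ c :=
        ae_restrict_of_ae (by simpa [ae_iff] using volume_setOf_inner_eq hv c)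
      have : ∀ᵐ x ∂volume.restrict K, False := by
        filter_upwards [h, hnull] with x h1 h2 using h2 h1
      simp only [eventually_false_iff_eq_bot, ae_eq_bot, Measure.restrict_eq_zero] at this
      simp [this] at hvol)
    (by
      filter_upwards [ae_restrict_mem hKm] with x hx
      linarith [hM (mem_image_of_mem _ hx)])
    (fun a b s t ha hb hab => by
      simp only [measureReal_def, Measure.restrict_apply (hmeas _)]
      rw [ENNReal.toReal_rpow, ENNReal.toReal_rpow, ← ENNReal.toReal_mul]
      refine ENNReal.toReal_mono
        (ne_top_of_le_ne_top hKc.measure_ne_top (measure_mono inter_subset_right))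
        ((prekopaLeindler_euclideanSpace ha hb hab d).measure_rpow_mul_le ha hb
          ((hmeas _).inter hKm) ((hmeas _).inter hKm) ((hmeas _).inter hKm) ?_)
      rintro x ⟨hx, hxK⟩ y ⟨hy, hyK⟩
      refine ⟨?_, hKconv hxK hyK ha.le hb.le hab⟩
      simp only [mem_ofPred_eq] at hx hy ⊢
      rw [inner_add_right, inner_smul_right, inner_smul_right]
      gcongr)
  rw [hV, measureReal_def, Measure.restrict_apply (hmeas c), inter_comm, Real.exp_neg] at key
  have hsplit : (volume K).toReal = (volume (K ∩ {x | ⟪v, x⟫ < c})).toReal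
      + (volume (K ∩ {x | c ≤ ⟪v, x⟫})).toReal := by
    have h1 := measureReal_inter_add_sdiff (μ := volume) (s := K) (hmeas c) hKc.measure_ne_top
    have h2 : K \ {x | ⟪v, x⟫ < c} = K ∩ {x | c ≤ ⟪v, x⟫} := by
      ext x; simp
    rw [h2] at h1
    exact h1.symm
  rw [div_le_iff₀ hvol]
  linarith
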